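/- Let n ≥ 2 and let A be a symmetric tridiagonal matrix with a_{ij} = 0 for |i−j| > 1, a_{i,i+1} = a_{i+1,i} > 0 for 1 ≤ i ≤ n−1, and a_{ii} ≥ 0 (the adjacency matrix of a weighted one-path graph, possibly with loops). Let d = A·𝟙, D = diag(d), S = D − A + (1/(𝟙ᵀd))·d·dᵀ, and for 1 ≤ q ≤ n−1 let w = e_q − e_{q+1}. Then the weighted derivative centrality satisfies a_{q,q+1}·wᵀS⁻¹DS⁻¹w = (Σ_{j=1}^{q} d_j)·(Σ_{j=q+1}^{n} d_j) / ((𝟙ᵀd)·a_{q,q+1}). (Equivalently, μ(q,q+1) = σ_{q−1}(1−σ_{q−1})/(λ_{q−1}π_{q−1}) in terms of the stationary distribution π of P = D⁻¹A and its superdiagonal entries λ.) -/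

import Mathlib

open Matrix BigOperators

/-- The indicator vector of the first `q` vertices of a path. -/
def initialIndicator (n q : ℕ) : Fin n → ℝ := fun j => if (j : ℕ) < q then 1 else 0

theorem laplacian_mulVec_apply {ι : Type*} [Fintype ι] [DecidableEq ι] (A : Matrix ι ι ℝ)
    (v : ι → ℝ) (i : ι) :
    ((diagonal (A *ᵥ fun _ => 1) - A) *ᵥ v) i = ∑ j, A i j * (v i - v j) := by
  rw [sub_mulVec, Pi.sub_apply, mulVec_diagonal]
  simp only [mulVec, dotProduct, mul_one, Finset.sum_mul, mul_sub, Finset.sum_sub_distrib]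

theorem laplacian_mulVec_const {ι : Type*} [Fintype ι] [DecidableEq ι] (A : Matrix ι ι ℝ)
    (c : ℝ) : (diagonal (A *ᵥ fun _ => 1) - A) *ᵥ (fun _ => c) = 0 := by
  ext i
  simp [laplacian_mulVec_apply]

/-- The Laplacian of a weighted path sends the indicator of an initial segment to the signed
indicator of the edge leaving it. -/
theorem laplacian_mulVec_initialIndicator {n : ℕ} {A : Matrix (Fin n) (Fin n) ℝ}
    (hAtri : ∀ i j : Fin n, (i : ℕ) + 1 < (j : ℕ) ∨ (j : ℕ) + 1 < (i : ℕ) → A i j = 0)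
    (hAsymm : A.IsSymm) (p : ℕ) (hp : p + 1 < n) :
    (diagonal (A *ᵥ fun _ => 1) - A) *ᵥ initialIndicator n (p + 1) =
      A ⟨p, by omega⟩ ⟨p + 1, hp⟩ •
        (Pi.single (⟨p, by omega⟩ : Fin n) 1 - Pi.single (⟨p + 1, hp⟩ : Fin n) 1) := by
  set x : Fin n := ⟨p, by omega⟩ with hx
  set y : Fin n := ⟨p + 1, hp⟩ with hy
  have hxy : x ≠ y := by simp [hx, hy]
  ext i
  rw [laplacian_mulVec_apply]
  have key : ∀ j, A i j * (initialIndicator n (p + 1) i - initialIndicator n (p + 1) j) =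
      (if i = x then if j = y then A x y else 0 else 0) -
        (if i = y then if j = x then A x y else 0 else 0) := by
    intro j
    by_cases hne : (i : ℕ) + 1 < (j : ℕ) ∨ (j : ℕ) + 1 < (i : ℕ)
    · have h₁ : ¬(i = x ∧ j = y) := by
        simp only [hx, hy, Fin.ext_iff]; omega
      have h₂ : ¬(i = y ∧ j = x) := by
        simp only [hx, hy, Fin.ext_iff]; omega
      rw [hAtri i j hne]
      simp only [← ite_and, h₁, h₂, if_false, zero_mul, sub_zero]
    · by_cases h₁ : i = x ∧ j = y
      · obtain ⟨rfl, rfl⟩ := h₁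
        simp [initialIndicator, hx, hy]
      by_cases h₂ : i = y ∧ j = x
      · obtain ⟨rfl, rfl⟩ := h₂
        rw [hAsymm.apply x y]
        simp [initialIndicator, hx, hy]
      have h₃ : (i : ℕ) < p + 1 ↔ (j : ℕ) < p + 1 := by
        simp only [hx, hy, Fin.ext_iff] at h₁ h₂; omega
      simp only [← ite_and, h₁, h₂, if_false, initialIndicator, h₃, sub_self, mul_zero]
  simp only [key, Finset.sum_sub_distrib]
  by_cases h₁ : i = x <;> by_cases h₂ : i = y <;>
    simp_all

theorem isSymm_laplacian_add_vecMulVec {ι : Type*} [DecidableEq ι] {A : Matrix ι ι ℝ}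
    (hA : A.IsSymm) (d : ι → ℝ) (c : ℝ) :
    (diagonal d - A + c • vecMulVec d d).IsSymm := by
  refine ((isSymm_diagonal d).sub hA).add (IsSymm.smul ?_ c)
  ext i j
  simp [vecMulVec_apply, mul_comm]

/-- The rank-one correction of the Laplacian of a weighted path is invertible. -/
theorem isUnit_det_laplacian_add_vecMulVec {n : ℕ} {A : Matrix (Fin n) (Fin n) ℝ}
    (hAtri : ∀ i j : Fin n, (i : ℕ) + 1 < (j : ℕ) ∨ (j : ℕ) + 1 < (i : ℕ) → A i j = 0)
    (hAsymm : A.IsSymm)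
    (hAoff : ∀ i : Fin n, ∀ h : (i : ℕ) + 1 < n, 0 < A i ⟨(i : ℕ) + 1, h⟩)
    {d : Fin n → ℝ} (hd : d = A *ᵥ fun _ => 1) (hsum : ∑ i, d i ≠ 0) :
    IsUnit (diagonal d - A + (1 / ∑ i, d i) • vecMulVec d d).det := by
  rw [isUnit_iff_ne_zero]
  intro hdet
  obtain ⟨v, hv, hSv⟩ := exists_mulVec_eq_zero_iff.mpr hdet
  have hL : (diagonal d - A).IsSymm := (isSymm_diagonal d).sub hAsymm
  have pair : ∀ u, ((diagonal d - A) *ᵥ u) ⬝ᵥ v + (1 / ∑ i, d i) * ((u ⬝ᵥ d) * (d ⬝ᵥ v)) = 0 := by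
    intro u
    have h := congrArg (u ⬝ᵥ ·) hSv
    simp only [add_mulVec, smul_mulVec, vecMulVec_mulVec, dotProduct_add, dotProduct_smul,
      dotProduct_zero, dotProduct_mulVec] at h
    rw [← mulVec_transpose, hL.eq] at h
    simpa [mul_comm, mul_left_comm] using h
  have hdv : d ⬝ᵥ v = 0 := by
    have h := pair fun _ => 1
    rw [hd, laplacian_mulVec_const, ← hd, zero_dotProduct, zero_add] at h
    have h₁ : (fun _ => (1 : ℝ)) ⬝ᵥ d = ∑ i, d i := by simp [dotProduct]
    rwa [h₁, ← mul_assoc, one_div_mul_cancel hsum, one_mul] at h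
  have step : ∀ p, ∀ hp : p + 1 < n, v ⟨p + 1, hp⟩ = v ⟨p, by omega⟩ := by
    intro p hp
    have h := pair (initialIndicator n (p + 1))
    rw [hdv, mul_zero, mul_zero, add_zero, hd,
      laplacian_mulVec_initialIndicator hAtri hAsymm p hp, smul_dotProduct, sub_dotProduct,
      single_one_dotProduct, single_one_dotProduct, smul_eq_mul] at h
    have h₁ := (mul_eq_zero.mp h).resolve_left (hAoff ⟨p, by omega⟩ hp).ne'
    linarith
  have const : ∀ p, ∀ hp : p < n, v ⟨p, hp⟩ = v ⟨0, by omega⟩ := by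
    intro p
    induction p with
    | zero => intro _; rfl
    | succ p ih => intro hp; rw [step p hp, ih]
  apply hv
  ext i
  have h : d ⬝ᵥ v = (∑ j, d j) * v i := by
    rw [dotProduct, Finset.sum_mul]
    refine Finset.sum_congr rfl fun j _ => ?_
    rw [const j j.2, ← const i i.2]
  exact (mul_eq_zero.mp (h.symm.trans hdv)).resolve_left hsum

/-- For a weighted one-path graph (tridiagonal adjacency matrix, possibly with loops),
the weighted derivative centrality of the edge `{q,q+1}` satisfies
`μ(q,q+1) = a_{q,q+1}·wᵀS⁻¹DS⁻¹w = (Σ_{j=1}^q d_j)·(Σ_{j=q+1}^n d_j)/((𝟙ᵀd)·a_{q,q+1})`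
(vertices `1,…,n` are represented by `Fin n`, so vertex `q` is `⟨q−1,_⟩`). -/
theorem stmt_12 {n : ℕ} (hn : 2 ≤ n)
    (A : Matrix (Fin n) (Fin n) ℝ)
    (hAtri : ∀ i j : Fin n, (i : ℕ) + 1 < (j : ℕ) ∨ (j : ℕ) + 1 < (i : ℕ) → A i j = 0)
    (hAsymm : A.IsSymm)
    (hAoff : ∀ i : Fin n, ∀ h : (i : ℕ) + 1 < n, 0 < A i ⟨(i : ℕ) + 1, h⟩)
    (hAdiag : ∀ i : Fin n, 0 ≤ A i i)
    (d : Fin n → ℝ) (hd : d = A.mulVec (fun _ => 1)) (hdpos : ∀ i, 0 < d i)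
    (D S : Matrix (Fin n) (Fin n) ℝ)
    (hD : D = Matrix.diagonal d)
    (hS : S = D - A + (1 / (∑ i, d i)) • Matrix.vecMulVec d d)
    (q : ℕ) (hq1 : 1 ≤ q) (hq2 : q ≤ n - 1)
    (w : Fin n → ℝ)
    (hw : w = Pi.single (⟨q - 1, by omega⟩ : Fin n) 1
            - Pi.single (⟨q, by omega⟩ : Fin n) 1)
    (a : ℝ) (ha : a = A (⟨q - 1, by omega⟩ : Fin n) (⟨q, by omega⟩ : Fin n)) :
    a * (w ⬝ᵥ (S⁻¹ * D * S⁻¹).mulVec w)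
      = (∑ j : Fin n, if (j : ℕ) < q then d j else 0)
          * (∑ j : Fin n, if q ≤ (j : ℕ) then d j else 0)
          / ((∑ i, d i) * a) := by
  obtain ⟨p, rfl⟩ : ∃ p, q = p + 1 := ⟨q - 1, by omega⟩
  have hp : p + 1 < n := by omega
  simp only [Nat.add_sub_cancel] at hw ha
  have ha0 : a ≠ 0 := by rw [ha]; exact (hAoff ⟨p, by omega⟩ hp).ne'
  have hT : ∑ i, d i ≠ 0 :=
    (Finset.sum_pos (fun i _ => hdpos i) ⟨⟨0, by omega⟩, Finset.mem_univ _⟩).ne'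
  have hunit : IsUnit S.det := by
    rw [hS, hD]; exact isUnit_det_laplacian_add_vecMulVec hAtri hAsymm hAoff hd hT
  have hsymm : S.IsSymm := by
    rw [hS, hD]; exact isSymm_laplacian_add_vecMulVec hAsymm d _
  set T := ∑ i, d i with hTdef
  set L := ∑ j : Fin n, if (j : ℕ) < p + 1 then d j else 0 with hLdef
  have hR : (∑ j : Fin n, if p + 1 ≤ (j : ℕ) then d j else 0) = T - L := by
    rw [hTdef, hLdef, ← Finset.sum_sub_distrib]
    refine Finset.sum_congr rfl fun j _ => ?_
    by_cases h : (j : ℕ) < p + 1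
    · simp [h, not_le.mpr h]
    · simp [h, not_lt.mp h]
  have hdu : d ⬝ᵥ initialIndicator n (p + 1) = L := by
    simp [dotProduct, initialIndicator, hLdef]
  have hd1 : (d ⬝ᵥ fun _ => L / T) = L := by
    rw [dotProduct, ← Finset.sum_mul, ← hTdef, mul_div_cancel₀ _ hT]
  set x : Fin n → ℝ := a⁻¹ • (initialIndicator n (p + 1) - fun _ => L / T) with hx
  have hSx : S *ᵥ x = w := by
    have hLap : (D - A) *ᵥ x = w := by
      rw [hx, mulVec_smul, mulVec_sub, hD, hd, laplacian_mulVec_const,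
        laplacian_mulVec_initialIndicator hAtri hAsymm p hp, sub_zero, ← ha, ← hw,
        inv_smul_smul₀ ha0]
    have hdx : d ⬝ᵥ x = 0 := by
      rw [hx, dotProduct_smul, dotProduct_sub, hdu, hd1, sub_self, smul_zero]
    rw [hS, add_mulVec, hLap, smul_mulVec, vecMulVec_mulVec, hdx]
    simp
  have hSw : S⁻¹ *ᵥ w = x := by
    rw [← hSx, mulVec_mulVec, nonsing_inv_mul _ hunit, one_mulVec]
  have hwS : w ᵥ* S⁻¹ = x := by
    rw [← mulVec_transpose, transpose_nonsing_inv, hsymm.eq, hSw]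
  have hquad : x ⬝ᵥ (D *ᵥ x) = a⁻¹ ^ 2 * (L - 2 * (L / T) * L + (L / T) ^ 2 * T) := by
    rw [hD, hTdef, hLdef, dotProduct]
    simp only [mulVec_diagonal, Finset.mul_sum, ← Finset.sum_sub_distrib,
      ← Finset.sum_add_distrib]
    rw [← hTdef, ← hLdef]
    refine Finset.sum_congr rfl fun j _ => ?_
    simp only [hx, initialIndicator, Pi.smul_apply, Pi.sub_apply, smul_eq_mul]
    split_ifs <;> ring
  rw [← mulVec_mulVec, ← mulVec_mulVec, dotProduct_mulVec, hwS, hSw, hquad, hR]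
  field_simp
  ring
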